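/- Let 0 < s < 1, n ≥ 1, and let φ: ℝⁿ → ℝ be a C¹ function satisfying |φ(x)| ≤ C/(1+|x|^(n+s)) and |∇φ(x)| ≤ C/(1+|x|^(n+s+1)) for all x, for some C > 0. Define I(x) = ∫_{ℝⁿ} |φ(x)-φ(y)|/|x-y|^(n+s) dy. Then there exists a constant C₁ > 0 such that I(x) ≤ C₁/(1+|x|^(n+s)) for all x ∈ ℝⁿ. -/

import Mathlib

open MeasureTheory

lemma one_add_rpow_le_two_rpow_mul {t q : ℝ} (ht : 0 ≤ t) (hq : 0 ≤ q) :
    (1 + t) ^ q ≤ 2 ^ q * (1 + t ^ q) := by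
  rcases le_total t 1 with h | h
  · calc (1 + t) ^ q ≤ 2 ^ q := by gcongr; linarith
      _ ≤ 2 ^ q * (1 + t ^ q) :=
        le_mul_of_one_le_right (by positivity) (by linarith [Real.rpow_nonneg ht q])
  · calc (1 + t) ^ q ≤ (2 * t) ^ q := by gcongr; linarith
      _ = 2 ^ q * t ^ q := Real.mul_rpow (by norm_num) ht
      _ ≤ 2 ^ q * (1 + t ^ q) := by gcongr; linarith

lemma div_one_add_rpow_le {C t q R : ℝ} (hC : 0 ≤ C) (ht : 0 ≤ t) (hq : 0 ≤ q) (hR : 0 < R)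
    (h : R ≤ 1 + t) : C / (1 + t ^ q) ≤ C * 2 ^ q / R ^ q := by
  have h1 : R ^ q ≤ 2 ^ q * (1 + t ^ q) :=
    (Real.rpow_le_rpow hR.le h hq).trans (one_add_rpow_le_two_rpow_mul ht hq)
  have h2 := Real.rpow_nonneg ht q
  rw [div_le_div_iff₀ (by linarith) (Real.rpow_pos_of_pos hR q), mul_assoc]
  gcongr

lemma integrable_min_one_two_mul_norm_mul_rpow {n : ℕ} (hn : 1 ≤ n) {s : ℝ} (hs : 0 < s)
    (hs1 : s < 1) : Integrable (fun u : EuclideanSpace ℝ (Fin n) =>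
      min 1 (2 * ‖u‖) * ‖u‖ ^ (-((n : ℝ) + s))) := by
  have : Nonempty (Fin n) := ⟨⟨0, hn⟩⟩
  have hpow : ∀ t : ℝ, 0 < t → t ^ (n - 1) * t ^ (-((n : ℝ) + s)) = t ^ (-1 - s) := by
    intro t ht
    rw [← Real.rpow_natCast, ← Real.rpow_add ht, Nat.cast_sub hn]
    congr 1
    push_cast
    ring
  rw [integrable_fun_norm_addHaar volume
    (f := fun t : ℝ => min 1 (2 * t) * t ^ (-((n : ℝ) + s)))]
  simp only [finrank_euclideanSpace, Fintype.card_fin, smul_eq_mul]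
  have heq : Set.EqOn (fun t : ℝ => min 1 (2 * t) * t ^ (-1 - s))
      (fun t => t ^ (n - 1) * (min 1 (2 * t) * t ^ (-((n : ℝ) + s)))) (Set.Ioi 0) := by
    intro t ht
    simp only
    rw [← hpow t ht]
    ring
  refine IntegrableOn.congr_fun ?_ heq measurableSet_Ioi
  have hmeas : Measurable (fun t : ℝ => min 1 (2 * t) * t ^ (-1 - s)) := by fun_prop
  rw [← Set.Ioc_union_Ioi_eq_Ioi zero_le_one]
  refine IntegrableOn.union ?_ ?_
  · have h : IntegrableOn (fun t : ℝ => 2 * t ^ (-s)) (Set.Ioc 0 1) := by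
      rw [← intervalIntegrable_iff_integrableOn_Ioc_of_le zero_le_one]
      exact (intervalIntegral.intervalIntegrable_rpow' (by linarith)).const_mul 2
    refine h.mono' hmeas.aestronglyMeasurable ?_
    filter_upwards [ae_restrict_mem measurableSet_Ioc] with t ht
    have ht0 : 0 < t := ht.1
    rw [Real.norm_of_nonneg (by positivity)]
    calc min 1 (2 * t) * t ^ (-1 - s) ≤ 2 * t * t ^ (-1 - s) := by
          gcongr
          exact min_le_right _ _
      _ = 2 * t ^ (-s) := by
          rw [mul_assoc, ← Real.rpow_one_add' ht0.le (by linarith)]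
          ring_nf
  · have h : IntegrableOn (fun t : ℝ => t ^ (-1 - s)) (Set.Ioi 1) :=
      integrableOn_Ioi_rpow_of_lt (by linarith) one_pos
    refine h.mono' hmeas.aestronglyMeasurable ?_
    filter_upwards [ae_restrict_mem measurableSet_Ioi] with t ht
    have ht0 : 0 < t := one_pos.trans ht
    rw [Real.norm_of_nonneg (by positivity)]
    exact mul_le_of_le_one_left (by positivity) (min_le_left _ _)

/-- With `R = (1 + ‖x‖) / 2`, the gradient bound controls the region `‖x - y‖ ≤ R` and the
bound on `φ` controls its complement. -/
lemma abs_sub_div_norm_rpow_le {E : Type*} [NormedAddCommGroup E] [NormedSpace ℝ E]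
    {p C : ℝ} (hp : 0 < p) (hC : 0 < C) {φ : E → ℝ} (hφ : Differentiable ℝ φ)
    (hb : ∀ x, |φ x| ≤ C / (1 + ‖x‖ ^ p))
    (hgrad : ∀ x, ‖fderiv ℝ φ x‖ ≤ C / (1 + ‖x‖ ^ (p + 1))) (x y : E) :
    |φ x - φ y| / ‖x - y‖ ^ p ≤ C * 2 ^ (p + 1) / ((1 + ‖x‖) / 2) ^ p *
      (min 1 (2 * ‖x - y‖) * ‖x - y‖ ^ (-p) + (1 + ‖y‖) ^ (-p)) := by
  have hx := norm_nonneg x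
  have hy := norm_nonneg y
  set R := (1 + ‖x‖) / 2 with hR
  have hR0 : 1 / 2 ≤ R := by linarith
  have hRpos : 0 < R := by linarith
  have hK : C * 2 ^ p ≤ C * 2 ^ (p + 1) := by
    gcongr
    · norm_num
    · linarith
  rw [Real.rpow_neg (norm_nonneg (x - y)), div_eq_mul_inv]
  rcases le_or_gt ‖x - y‖ R with h | h
  · have hball : ∀ z ∈ Metric.closedBall x R,
        ‖fderiv ℝ φ z‖ ≤ C * 2 ^ (p + 1) / R ^ (p + 1) := by
      intro z hz
      rw [mem_closedBall_iff_norm'] at hz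
      have := norm_sub_norm_le x z
      exact (hgrad z).trans
        (div_one_add_rpow_le hC.le (norm_nonneg z) (by linarith) hRpos (by linarith))
    have hmv := (convex_closedBall x R).norm_image_sub_le_of_norm_fderiv_le
      (fun z _ => hφ z) hball (mem_closedBall_iff_norm'.2 h)
      (Metric.mem_closedBall_self hRpos.le)
    rw [Real.norm_eq_abs] at hmv
    have hmin : ‖x - y‖ / R ≤ min 1 (2 * ‖x - y‖) := by
      refine le_min ((div_le_one hRpos).2 h) ?_
      rw [div_le_iff₀ hRpos]
      nlinarith [norm_nonneg (x - y)]
    have hnum : |φ x - φ y| ≤ C * 2 ^ (p + 1) / R ^ p * min 1 (2 * ‖x - y‖) := by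
      calc |φ x - φ y| ≤ C * 2 ^ (p + 1) / R ^ (p + 1) * ‖x - y‖ := hmv
        _ = C * 2 ^ (p + 1) / R ^ p * (‖x - y‖ / R) := by
          rw [Real.rpow_add_one hRpos.ne' p]
          field_simp
        _ ≤ _ := by gcongr
    calc |φ x - φ y| * (‖x - y‖ ^ p)⁻¹
        ≤ C * 2 ^ (p + 1) / R ^ p * min 1 (2 * ‖x - y‖) * (‖x - y‖ ^ p)⁻¹ := by gcongr
      _ = C * 2 ^ (p + 1) / R ^ p * (min 1 (2 * ‖x - y‖) * (‖x - y‖ ^ p)⁻¹) := by ring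
      _ ≤ _ := by
        gcongr
        exact le_add_of_nonneg_right (by positivity)
  · have hφx : |φ x| ≤ C * 2 ^ (p + 1) / R ^ p := by
      refine ((hb x).trans (div_one_add_rpow_le hC.le hx hp.le hRpos (by linarith))).trans ?_
      gcongr
    have hφy : |φ y| ≤ C * 2 ^ (p + 1) * (1 + ‖y‖) ^ (-p) := by
      rw [Real.rpow_neg (by linarith), ← div_eq_mul_inv]
      refine ((hb y).trans (div_one_add_rpow_le hC.le hy hp.le (by linarith) le_rfl)).trans ?_
      gcongr
    have hinv : (‖x - y‖ ^ p)⁻¹ ≤ (R ^ p)⁻¹ := by gcongr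
    rw [min_eq_left (by linarith)]
    calc |φ x - φ y| * (‖x - y‖ ^ p)⁻¹
        ≤ (|φ x| + |φ y|) * (‖x - y‖ ^ p)⁻¹ := by
          gcongr
          exact abs_sub _ _
      _ = |φ x| * (‖x - y‖ ^ p)⁻¹ + |φ y| * (‖x - y‖ ^ p)⁻¹ := by ring
      _ ≤ C * 2 ^ (p + 1) / R ^ p * (‖x - y‖ ^ p)⁻¹ +
          C * 2 ^ (p + 1) * (1 + ‖y‖) ^ (-p) * (R ^ p)⁻¹ := by gcongr
      _ = _ := by ring

theorem stmt2 (n : ℕ) (hn : 1 ≤ n) (s C : ℝ) (hs : 0 < s) (hs1 : s < 1) (hC : 0 < C)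
    (φ : EuclideanSpace ℝ (Fin n) → ℝ) (hφ : ContDiff ℝ 1 φ)
    (hb : ∀ x, |φ x| ≤ C / (1 + ‖x‖ ^ ((n : ℝ) + s)))
    (hgrad : ∀ x, ‖fderiv ℝ φ x‖ ≤ C / (1 + ‖x‖ ^ ((n : ℝ) + s + 1))) :
    ∃ C₁ : ℝ, 0 < C₁ ∧ ∀ x : EuclideanSpace ℝ (Fin n),
      (∫ y, |φ x - φ y| / ‖x - y‖ ^ ((n : ℝ) + s)) ≤ C₁ / (1 + ‖x‖ ^ ((n : ℝ) + s)) := by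
  have hG := integrable_min_one_two_mul_norm_mul_rpow hn hs hs1
  have hJ : Integrable (fun y : EuclideanSpace ℝ (Fin n) => (1 + ‖y‖) ^ (-((n : ℝ) + s))) :=
    integrable_one_add_norm (by simpa using hs)
  have hp : 0 < (n : ℝ) + s := by positivity
  set p := (n : ℝ) + s
  set A := ∫ u : EuclideanSpace ℝ (Fin n), min 1 (2 * ‖u‖) * ‖u‖ ^ (-p)
  set B := ∫ y : EuclideanSpace ℝ (Fin n), (1 + ‖y‖) ^ (-p)
  have hA : 0 ≤ A := integral_nonneg fun u => by positivity
  have hB : 0 ≤ B := integral_nonneg fun u => by positivity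
  refine ⟨C * 2 ^ (p + 1) * (2 * 2 ^ p) * (A + B + 1), by positivity, fun x => ?_⟩
  have hGx := hG.comp_sub_left x
  have hR : (1 + ‖x‖ ^ p) ≤ 2 * 2 ^ p * ((1 + ‖x‖) / 2) ^ p := by
    have h1 : (1 : ℝ) ≤ (1 + ‖x‖) ^ p := Real.one_le_rpow (by linarith [norm_nonneg x]) hp.le
    have h2 : ‖x‖ ^ p ≤ (1 + ‖x‖) ^ p := by gcongr; linarith
    rw [mul_assoc, ← Real.mul_rpow (by norm_num) (by positivity), mul_div_cancel₀ _ two_ne_zero]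
    linarith
  calc (∫ y, |φ x - φ y| / ‖x - y‖ ^ p)
      ≤ ∫ y, C * 2 ^ (p + 1) / ((1 + ‖x‖) / 2) ^ p *
          (min 1 (2 * ‖x - y‖) * ‖x - y‖ ^ (-p) + (1 + ‖y‖) ^ (-p)) :=
        integral_mono_of_nonneg (.of_forall fun y => by positivity)
          ((hGx.add hJ).const_mul _)
          (.of_forall (abs_sub_div_norm_rpow_le hp hC (hφ.differentiable one_ne_zero) hb hgrad x))
    _ = C * 2 ^ (p + 1) / ((1 + ‖x‖) / 2) ^ p * (A + B) := by
        rw [integral_const_mul, integral_add hGx hJ,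
          integral_sub_left_eq_self (fun u => min 1 (2 * ‖u‖) * ‖u‖ ^ (-p)) volume x]
    _ ≤ C * 2 ^ (p + 1) / ((1 + ‖x‖) / 2) ^ p * (A + B + 1) :=
        mul_le_mul_of_nonneg_left (by linarith) (by positivity)
    _ ≤ C * 2 ^ (p + 1) * (2 * 2 ^ p) * (A + B + 1) / (1 + ‖x‖ ^ p) := by
        rw [le_div_iff₀ (by positivity)]
        calc _ ≤ C * 2 ^ (p + 1) / ((1 + ‖x‖) / 2) ^ p * (A + B + 1) *
              (2 * 2 ^ p * ((1 + ‖x‖) / 2) ^ p) := by gcongr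
          _ = _ := by field_simp
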